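/- Consider a discrete Poisson channel with memory of order K ≥ 1, coefficients π ∈ [0,∞)^K and dark noise d > 0, blocklength N ≥ 1 and total-power budget P ≥ 0. Suppose the pair (x1, x2) ∈ [0,∞)^N × [0,∞)^N with ∑_i x1_i ≤ P and ∑_i x2_i ≤ P minimizes P_e(x1*π, x2*π) among all such pairs. Let λ := x1*π, μ := x2*π (vectors of length n := N+K−1), a_i := log((λ_i + d)/(μ_i + d)), b := ∑_{i=0}^{n−1}(λ_i − μ_i), and, with Y_0, …, Y_{n−1} independent and Y_i ~ Poisson(λ_i + d), let D_i := E[ (Y_i/(λ_i + d) − 1) · 1{∑_{j=0}^{n−1} a_j Y_j < b} ] (where D_i is taken as defined for indices 0 ≤ i ≤ n−1). Then there exists ν ≤ 0 such that for every j ∈ {0, …, N−1}: if x1_j > 0 then ∑_{i=0}^{K−1} D_{j+i} π_i = ν, and if x1_j = 0 then ∑_{i=0}^{K−1} D_{j+i} π_i ≥ ν; moreover, if ∑_{j=0}^{N−1} x1_j < P then ν = 0. -/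

import Mathlib

open scoped BigOperators

/-- Poisson probability mass at `k` for mean `a`. -/
noncomputable def poissonPdf (a : ℝ) (k : ℕ) : ℝ :=
  Real.exp (-a) * a ^ k / (Nat.factorial k : ℝ)

/-- Joint pmf of independent Poisson coordinates with mean vector `m`. -/
noncomputable def prodPdf {n : ℕ} (m : Fin n → ℝ) (y : Fin n → ℕ) : ℝ :=
  ∏ i, poissonPdf (m i) (y i)

/-- Average error probability of a decoder `g` for the binary hypothesis test between
independent Poisson observations with mean vectors `lam + d` (hypothesis 1) and
`mu + d` (hypothesis 2); `g y = true` means "decide hypothesis 1". -/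
noncomputable def errProb {n : ℕ} (d : ℝ) (lam mu : Fin n → ℝ)
    (g : (Fin n → ℕ) → Bool) : ℝ :=
  (1/2) * (∑' y : Fin n → ℕ, if g y = false then prodPdf (fun i => lam i + d) y else 0)
  + (1/2) * (∑' y : Fin n → ℕ, if g y = true then prodPdf (fun i => mu i + d) y else 0)

/-- Minimal (maximum-likelihood) average error probability. -/
noncomputable def Pe {n : ℕ} (d : ℝ) (lam mu : Fin n → ℝ) : ℝ :=
  ⨅ g : (Fin n → ℕ) → Bool, errProb d lam mu g

/-- Convolution of a codeword `x` of length `N` with channel coefficients `p` of length `K`,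
giving the mean vector of length `N + K - 1`. -/
noncomputable def cconv {N K : ℕ} (x : Fin N → ℝ) (p : Fin K → ℝ) :
    Fin (N + K - 1) → ℝ :=
  fun i => ∑ j : Fin K,
    p j * (if h : (j : ℕ) ≤ (i : ℕ) ∧ (i : ℕ) - (j : ℕ) < N
      then x ⟨(i : ℕ) - (j : ℕ), h.2⟩ else 0)

/-- Sum of the `k` largest entries of `v`. -/
noncomputable def topSum {m : ℕ} (v : Fin m → ℝ) (k : ℕ) : ℝ :=
  ⨆ s ∈ {s : Finset (Fin m) | s.card = k}, ∑ i ∈ s, v i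

/-- Weak submajorization (from below): every top-`k` sum of `u` is at most that of `v`. -/
def weakSubmaj {m : ℕ} (u v : Fin m → ℝ) : Prop :=
  ∀ k, 1 ≤ k → k ≤ m → topSum u k ≤ topSum v k

theorem summable_prod_pow_div_factorial (M : ℝ) (hM : 0 ≤ M) (n : ℕ) :
    Summable fun y : Fin n → ℕ => ∏ i, M ^ y i / (Nat.factorial (y i) : ℝ) := by
  induction n with
  | zero => exact (hasSum_fintype _).summable
  | succ n ih =>
    rw [← (Fin.consEquiv fun _ : Fin (n + 1) => ℕ).summable_iff]
    have h := (Real.summable_pow_div_factorial M).mul_of_nonneg ih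
      (fun k => by positivity) (fun y => Finset.prod_nonneg fun i _ => by positivity)
    refine h.congr fun z => ?_
    simp only [Function.comp_apply, Fin.consEquiv_apply, Fin.prod_univ_succ, Fin.cons_zero,
      Fin.cons_succ]

theorem poissonPdf_nonneg {a : ℝ} (ha : 0 ≤ a) (k : ℕ) : 0 ≤ poissonPdf a k := by
  unfold poissonPdf; positivity

theorem poissonPdf_le {a M : ℝ} (ha : 0 ≤ a) (haM : a ≤ M) (k : ℕ) :
    poissonPdf a k ≤ M ^ k / (Nat.factorial k : ℝ) := by
  unfold poissonPdf
  have h1 : Real.exp (-a) ≤ 1 := Real.exp_le_one_iff.2 (by linarith)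
  have h2 : a ^ k ≤ M ^ k := by gcongr
  have h3 : Real.exp (-a) * a ^ k ≤ M ^ k := by
    calc Real.exp (-a) * a ^ k ≤ 1 * M ^ k := by gcongr
      _ = M ^ k := one_mul _
  gcongr

theorem hasDerivAt_poissonPdf {a : ℝ} (ha : 0 < a) (k : ℕ) :
    HasDerivAt (fun s => poissonPdf s k) (poissonPdf a k * ((k : ℝ) / a - 1)) a := by
  have h : HasDerivAt (fun s : ℝ => Real.exp (-s) * s ^ k / (Nat.factorial k : ℝ))
      ((Real.exp (-a) * -1 * a ^ k + Real.exp (-a) * (k * a ^ (k - 1) * 1)) /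
        (Nat.factorial k : ℝ)) a :=
    (((hasDerivAt_id a).neg.exp).mul ((hasDerivAt_id a).pow k)).div_const _
  refine h.congr_deriv ?_
  unfold poissonPdf
  cases k with
  | zero => simp
  | succ k =>
    have : (Nat.factorial (k + 1) : ℝ) ≠ 0 := by positivity
    simp only [Nat.add_sub_cancel]
    field_simp
    ring

theorem prodPdf_nonneg {n : ℕ} {m : Fin n → ℝ} (hm : ∀ i, 0 ≤ m i) (y : Fin n → ℕ) :
    0 ≤ prodPdf m y :=
  Finset.prod_nonneg fun i _ => poissonPdf_nonneg (hm i) _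

theorem prodPdf_le {n : ℕ} {m : Fin n → ℝ} {M : ℝ} (hm : ∀ i, 0 ≤ m i) (hM : ∀ i, m i ≤ M)
    (y : Fin n → ℕ) : prodPdf m y ≤ ∏ i, M ^ y i / (Nat.factorial (y i) : ℝ) :=
  Finset.prod_le_prod (fun i _ => poissonPdf_nonneg (hm i) _)
    fun i _ => poissonPdf_le (hm i) (hM i) _

theorem summable_prodPdf {n : ℕ} {m : Fin n → ℝ} (hm : ∀ i, 0 ≤ m i) :
    Summable (prodPdf m) :=
  Summable.of_nonneg_of_le (prodPdf_nonneg hm)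
    (prodPdf_le hm fun i => Finset.single_le_sum (fun j _ => hm j) (Finset.mem_univ i))
    (summable_prod_pow_div_factorial (∑ i, m i) (Finset.sum_nonneg fun i _ => hm i) n)

/-- Uniform bound on the partial derivatives of the joint pmf over a box of means. -/
theorem abs_prodPdf_mul_score_le {n : ℕ} {m : Fin n → ℝ} {c M : ℝ} (hc : 0 < c)
    (hm : ∀ i, c ≤ m i) (hM : ∀ i, m i ≤ M) (y : Fin n → ℕ) (i : Fin n) :
    |prodPdf m y * ((y i : ℝ) / m i - 1)| ≤
      (1 / c + 1) * ∏ j, (2 * M) ^ y j / (Nat.factorial (y j) : ℝ) := by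
  have hm0 : ∀ i, 0 < m i := fun i => hc.trans_le (hm i)
  have hyi : ((y i : ℝ) + 1) ≤ ∏ j, (2 : ℝ) ^ y j := by
    calc ((y i : ℝ) + 1) ≤ 2 ^ y i := by exact_mod_cast Nat.lt_two_pow_self
      _ ≤ ∏ j, (2 : ℝ) ^ y j := by
        rw [Finset.prod_pow_eq_pow_sum]
        exact pow_le_pow_right₀ one_le_two
          (Finset.single_le_sum (fun j _ => Nat.zero_le (y j)) (Finset.mem_univ i))
  have hscore : |(y i : ℝ) / m i - 1| ≤ (1 / c + 1) * ((y i : ℝ) + 1) := by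
    have h1 : (y i : ℝ) / m i ≤ (y i : ℝ) / c := by gcongr; exact hm i
    have h0 : 0 ≤ (y i : ℝ) / m i := by have := hm0 i; positivity
    have h2 : (1 / c + 1) * ((y i : ℝ) + 1) = (y i : ℝ) / c + y i + 1 / c + 1 := by ring
    have h3 : 0 < 1 / c := by positivity
    have h4 : (0 : ℝ) ≤ y i := by positivity
    rw [abs_le]
    constructor <;> linarith [div_nonneg h4 hc.le]
  have hp0 := prodPdf_nonneg (fun i => (hm0 i).le) y
  rw [abs_mul, abs_of_nonneg hp0]
  have hpow : ∏ j, (2 * M) ^ y j / (Nat.factorial (y j) : ℝ) =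
      (∏ j, M ^ y j / (Nat.factorial (y j) : ℝ)) * ∏ j, (2 : ℝ) ^ y j := by
    rw [← Finset.prod_mul_distrib]
    exact Finset.prod_congr rfl fun j _ => by rw [mul_pow]; ring
  rw [hpow]
  have hple := prodPdf_le (fun i => (hm0 i).le) hM y
  calc prodPdf m y * |(y i : ℝ) / m i - 1|
      ≤ (∏ j, M ^ y j / (Nat.factorial (y j) : ℝ)) *
        ((1 / c + 1) * ∏ j, (2 : ℝ) ^ y j) := by
        refine mul_le_mul hple (hscore.trans ?_) (abs_nonneg _) (hp0.trans hple)
        gcongr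
    _ = _ := by ring

theorem hasDerivAt_prodPdf_line {n : ℕ} {m w : Fin n → ℝ} {t : ℝ}
    (hm : ∀ i, 0 < m i + t * w i) (y : Fin n → ℕ) :
    HasDerivAt (fun s => prodPdf (fun i => m i + s * w i) y)
      (∑ i, w i * (prodPdf (fun i => m i + t * w i) y *
        ((y i : ℝ) / (m i + t * w i) - 1))) t := by
  have hline : ∀ i, HasDerivAt (fun s => m i + s * w i) (w i) t := fun i => by
    simpa using ((hasDerivAt_id t).mul_const (w i)).const_add (m i)
  have hcoord : ∀ i, HasDerivAt (fun s => poissonPdf (m i + s * w i) (y i))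
      (poissonPdf (m i + t * w i) (y i) * ((y i : ℝ) / (m i + t * w i) - 1) * w i) t := fun i =>
    HasDerivAt.comp (h₂ := fun s => poissonPdf s (y i)) t
      (hasDerivAt_poissonPdf (hm i) (y i)) (hline i)
  have h := HasDerivAt.fun_finsetProd (u := Finset.univ) fun i _ => hcoord i
  refine h.congr_deriv (Finset.sum_congr rfl fun i _ => ?_)
  unfold prodPdf
  rw [← Finset.prod_erase_mul _ _ (Finset.mem_univ i), smul_eq_mul]
  ring

theorem summable_prodPdf_mul_score {n : ℕ} {m : Fin n → ℝ} {c : ℝ} (hc : 0 < c)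
    (hm : ∀ i, c ≤ m i) (S : (Fin n → ℕ) → Prop) [DecidablePred S] (i : Fin n) :
    Summable fun y => prodPdf m y * (((y i : ℝ) / m i - 1) * (if S y then 1 else 0)) := by
  have hm0 : ∀ i, 0 ≤ m i := fun i => hc.le.trans (hm i)
  have hM : ∀ i, m i ≤ ∑ j, m j :=
    fun i => Finset.single_le_sum (fun j _ => hm0 j) (Finset.mem_univ i)
  refine Summable.of_norm_bounded
    ((summable_prod_pow_div_factorial (2 * ∑ j, m j)
      (mul_nonneg zero_le_two (Finset.sum_nonneg fun i _ => hm0 i)) n).mul_left (1 / c + 1))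
    fun y => ?_
  refine le_trans ?_ (abs_prodPdf_mul_score_le hc hm hM y i)
  rw [← mul_assoc, norm_mul, Real.norm_eq_abs]
  refine mul_le_of_le_one_right (abs_nonneg _) ?_
  split_ifs <;> simp

/-- The mass that a product of Poisson laws gives to a set is differentiable along lines of
mean vectors. -/
theorem hasDerivAt_tsum_prodPdf {n : ℕ} {m : Fin n → ℝ} {c : ℝ} (hc : 0 < c)
    (hm : ∀ i, c ≤ m i) (w : Fin n → ℝ) (S : (Fin n → ℕ) → Prop) [DecidablePred S] :
    HasDerivAt (fun t => ∑' y, if S y then prodPdf (fun i => m i + t * w i) y else 0)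
      (∑ i, w i *
        ∑' y, prodPdf m y * (((y i : ℝ) / m i - 1) * (if S y then 1 else 0))) 0 := by
  set W := ∑ i, |w i| with hW
  have hW0 : 0 ≤ W := Finset.sum_nonneg fun i _ => abs_nonneg _
  have hwW : ∀ i, |w i| ≤ W :=
    fun i => Finset.single_le_sum (f := fun i => |w i|) (fun j _ => abs_nonneg _)
      (Finset.mem_univ i)
  set ε := c / (2 * (W + 1)) with hε
  have hε0 : 0 < ε := by positivity
  have hm0 : ∀ i, 0 ≤ m i := fun i => hc.le.trans (hm i)
  set M := ∑ j, m j + c with hM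
  have hM0 : 0 ≤ M := add_nonneg (Finset.sum_nonneg fun i _ => hm0 i) hc.le
  have hmM : ∀ i, m i ≤ ∑ j, m j :=
    fun i => Finset.single_le_sum (fun j _ => hm0 j) (Finset.mem_univ i)
  have hbox : ∀ t ∈ Metric.ball (0 : ℝ) ε, ∀ i,
      c / 2 ≤ m i + t * w i ∧ m i + t * w i ≤ M := by
    intro t ht i
    have ht' : |t| ≤ ε := by simpa using (Metric.mem_ball.1 ht).le
    have h1 : |t * w i| ≤ c / 2 := by
      rw [abs_mul]
      calc |t| * |w i| ≤ ε * (W + 1) := by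
            gcongr
            linarith [hwW i]
        _ = c / 2 := by rw [hε]; field_simp
    have h2 := abs_le.1 h1
    constructor
    · linarith [hm i]
    · linarith [hmM i]
  have key := hasDerivAt_tsum_of_isPreconnected
    (g := fun (y : Fin n → ℕ) t => if S y then prodPdf (fun i => m i + t * w i) y else 0)
    (g' := fun (y : Fin n → ℕ) t => if S y then ∑ i, w i *
      (prodPdf (fun i => m i + t * w i) y * ((y i : ℝ) / (m i + t * w i) - 1)) else 0)
    (y₀ := (0 : ℝ)) (y := (0 : ℝ))
    (u := fun y => W * ((1 / (c / 2) + 1) *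
      ∏ j, (2 * M) ^ y j / (Nat.factorial (y j) : ℝ)))
    (((summable_prod_pow_div_factorial (2 * M) (by positivity) n).mul_left _).mul_left _)
    Metric.isOpen_ball (convex_ball (0 : ℝ) ε).isPreconnected
    (fun y t ht => by
      by_cases hy : S y
      · simp only [hy, if_true]
        exact hasDerivAt_prodPdf_line
          (fun i => (half_pos hc).trans_le (hbox t ht i).1) y
      · simpa only [hy, if_false] using hasDerivAt_const t (0 : ℝ))
    (fun y t ht => by
      have hB : ∀ i, |w i * (prodPdf (fun i => m i + t * w i) y *
          ((y i : ℝ) / (m i + t * w i) - 1))| ≤ |w i| * ((1 / (c / 2) + 1) *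
            ∏ j, (2 * M) ^ y j / (Nat.factorial (y j) : ℝ)) := fun i => by
        rw [abs_mul]
        exact mul_le_mul_of_nonneg_left (abs_prodPdf_mul_score_le (half_pos hc)
          (fun i => (hbox t ht i).1) (fun i => (hbox t ht i).2) y i) (abs_nonneg _)
      by_cases hy : S y
      · simp only [hy, if_true]
        rw [hW, Finset.sum_mul]
        exact (Finset.abs_sum_le_sum_abs _ _).trans (Finset.sum_le_sum fun i _ => hB i)
      · simp only [hy, if_false, norm_zero]
        have : 0 ≤ ∏ j, (2 * M) ^ y j / (Nat.factorial (y j) : ℝ) :=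
          Finset.prod_nonneg fun j _ => by positivity
        positivity)
    (Metric.mem_ball_self hε0)
    (by
      simp only [zero_mul, add_zero]
      refine Summable.of_nonneg_of_le (fun y => ?_) (fun y => ?_) (summable_prodPdf hm0)
      · split_ifs
        exacts [prodPdf_nonneg hm0 y, le_rfl]
      · split_ifs
        exacts [le_rfl, prodPdf_nonneg hm0 y])
    (Metric.mem_ball_self hε0)
  refine key.congr_deriv ?_
  simp only [zero_mul, add_zero]
  simp only [← tsum_mul_left]
  rw [← Summable.tsum_finsetSum fun i _ => (summable_prodPdf_mul_score hc hm S i).mul_left _]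
  refine tsum_congr fun y => ?_
  split_ifs <;> simp

theorem errProb_nonneg {n : ℕ} {d : ℝ} {lam mu : Fin n → ℝ} (hl : ∀ i, 0 ≤ lam i + d)
    (hm : ∀ i, 0 ≤ mu i + d) (g : (Fin n → ℕ) → Bool) : 0 ≤ errProb d lam mu g := by
  unfold errProb
  refine add_nonneg (mul_nonneg (by norm_num) (tsum_nonneg fun y => ?_))
    (mul_nonneg (by norm_num) (tsum_nonneg fun y => ?_))
  · split_ifs
    exacts [prodPdf_nonneg hl y, le_rfl]
  · split_ifs
    exacts [prodPdf_nonneg hm y, le_rfl]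

theorem Pe_le_errProb {n : ℕ} {d : ℝ} {lam mu : Fin n → ℝ} (hl : ∀ i, 0 ≤ lam i + d)
    (hm : ∀ i, 0 ≤ mu i + d) (g : (Fin n → ℕ) → Bool) : Pe d lam mu ≤ errProb d lam mu g :=
  ciInf_le ⟨0, by rintro _ ⟨g, rfl⟩; exact errProb_nonneg hl hm g⟩ g

theorem errProb_eq_tsum {n : ℕ} {d : ℝ} {lam mu : Fin n → ℝ} (hl : ∀ i, 0 ≤ lam i + d)
    (hm : ∀ i, 0 ≤ mu i + d) (g : (Fin n → ℕ) → Bool) :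
    Summable (fun y => if g y = false then prodPdf (fun i => lam i + d) y
      else prodPdf (fun i => mu i + d) y) ∧
    errProb d lam mu g = (1 / 2) * ∑' y, (if g y = false then prodPdf (fun i => lam i + d) y
      else prodPdf (fun i => mu i + d) y) := by
  have h1 : Summable fun y => if g y = false then prodPdf (fun i => lam i + d) y else 0 := by
    refine Summable.of_nonneg_of_le (fun y => ?_) (fun y => ?_) (summable_prodPdf hl)
    · split_ifs
      exacts [prodPdf_nonneg hl y, le_rfl]
    · split_ifs
      exacts [le_rfl, prodPdf_nonneg hl y]
  have h2 : Summable fun y => if g y = true then prodPdf (fun i => mu i + d) y else 0 := by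
    refine Summable.of_nonneg_of_le (fun y => ?_) (fun y => ?_) (summable_prodPdf hm)
    · split_ifs
      exacts [prodPdf_nonneg hm y, le_rfl]
    · split_ifs
      exacts [le_rfl, prodPdf_nonneg hm y]
  have h3 : (fun y => (if g y = false then prodPdf (fun i => lam i + d) y else 0) +
      (if g y = true then prodPdf (fun i => mu i + d) y else 0)) =
      fun y => if g y = false then prodPdf (fun i => lam i + d) y
        else prodPdf (fun i => mu i + d) y := by
    funext y
    cases g y <;> simp
  rw [← h3]
  refine ⟨h1.add h2, ?_⟩
  rw [h1.tsum_add h2, mul_add]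
  rfl

theorem Pe_eq_errProb_of_forall {n : ℕ} {d : ℝ} {lam mu : Fin n → ℝ}
    (hl : ∀ i, 0 ≤ lam i + d) (hm : ∀ i, 0 ≤ mu i + d) (g : (Fin n → ℕ) → Bool)
    (hf : ∀ y, g y = false → prodPdf (fun i => lam i + d) y ≤ prodPdf (fun i => mu i + d) y)
    (ht : ∀ y, g y = true → prodPdf (fun i => mu i + d) y ≤ prodPdf (fun i => lam i + d) y) :
    Pe d lam mu = errProb d lam mu g := by
  refine le_antisymm (Pe_le_errProb hl hm g) (le_ciInf fun g' => ?_)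
  rw [(errProb_eq_tsum hl hm g).2, (errProb_eq_tsum hl hm g').2]
  refine mul_le_mul_of_nonneg_left (Summable.tsum_le_tsum (fun y => ?_)
    (errProb_eq_tsum hl hm g).1 (errProb_eq_tsum hl hm g').1) (by norm_num)
  have h1 := hf y
  have h2 := ht y
  cases hg : g y <;> cases hg' : g' y <;> simp_all

theorem prodPdf_eq_mul_exp {n : ℕ} {l m : Fin n → ℝ} (hl : ∀ i, 0 < l i) (hm : ∀ i, 0 < m i)
    (y : Fin n → ℕ) :
    prodPdf l y = prodPdf m y *
      Real.exp (∑ i, Real.log (l i / m i) * (y i : ℝ) - ∑ i, (l i - m i)) := by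
  unfold prodPdf
  rw [← Finset.sum_sub_distrib, Real.exp_sum, ← Finset.prod_mul_distrib]
  refine Finset.prod_congr rfl fun i _ => ?_
  unfold poissonPdf
  have hli := hl i
  have hmi := hm i
  have h1 : Real.exp (Real.log (l i / m i) * (y i : ℝ) - (l i - m i)) =
      (l i / m i) ^ y i * (Real.exp (-l i) * Real.exp (m i)) := by
    rw [← Real.exp_add, mul_comm (Real.log _), sub_eq_add_neg, Real.exp_add,
      Real.exp_nat_mul, Real.exp_log (by positivity)]
    congr 2
    ring
  rw [h1, div_pow, Real.exp_neg (m i)]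
  field_simp

theorem cconv_nonneg {N K : ℕ} {x : Fin N → ℝ} {p : Fin K → ℝ} (hx : ∀ i, 0 ≤ x i)
    (hp : ∀ j, 0 ≤ p j) (i : Fin (N + K - 1)) : 0 ≤ cconv x p i := by
  refine Finset.sum_nonneg fun j _ => mul_nonneg (hp j) ?_
  split_ifs
  exacts [hx _, le_rfl]

theorem cconv_add_mul {N K : ℕ} (x v : Fin N → ℝ) (p : Fin K → ℝ) (t : ℝ)
    (i : Fin (N + K - 1)) :
    cconv (fun j => x j + t * v j) p i = cconv x p i + t * cconv v p i := by
  unfold cconv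
  rw [Finset.mul_sum, ← Finset.sum_add_distrib]
  refine Finset.sum_congr rfl fun j _ => ?_
  split_ifs <;> ring

/-- The adjoint of convolution with `p` is correlation with `p`. -/
theorem sum_cconv_mul {N K : ℕ} (v : Fin N → ℝ) (p : Fin K → ℝ) (D : Fin (N + K - 1) → ℝ) :
    ∑ i, cconv v p i * D i = ∑ j : Fin N, v j * ∑ i : Fin K,
      D ⟨(j : ℕ) + (i : ℕ), by have := j.isLt; have := i.isLt; omega⟩ * p i := by
  unfold cconv
  simp only [Finset.sum_mul, Finset.mul_sum]
  rw [Finset.sum_comm, Finset.sum_comm (s := (Finset.univ : Finset (Fin N)))]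
  refine Finset.sum_congr rfl fun k _ => Eq.symm ?_
  refine Fintype.sum_of_injective
    (fun j : Fin N => (⟨(j : ℕ) + (k : ℕ), by have := j.isLt; have := k.isLt; omega⟩ :
      Fin (N + K - 1))) (fun j j' h => ?_) _ _ (fun i hi => ?_) (fun j => ?_)
  · simpa [Fin.ext_iff] using h
  · rw [dif_neg]
    · simp
    · rintro ⟨h1, h2⟩
      exact hi ⟨⟨(i : ℕ) - k, h2⟩, Fin.ext (Nat.sub_add_cancel h1)⟩
  · have h : (k : ℕ) ≤ (j : ℕ) + k ∧ (j : ℕ) + k - k < N := ⟨by omega, by simp⟩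
    rw [dif_pos h]
    simp only [Nat.add_sub_cancel]
    ring

theorem HasDerivAt.nonneg_of_forall_le {f : ℝ → ℝ} {L : ℝ} (hf : HasDerivAt f L 0)
    (h : ∀ t, 0 < t → t ≤ 1 → f 0 ≤ f t) : 0 ≤ L := by
  have ht := (hasDerivWithinAt_iff_tendsto_slope' (s := Set.Ioi (0 : ℝ))
    (by simp)).1 hf.hasDerivWithinAt
  refine ge_of_tendsto ht ?_
  filter_upwards [Ioc_mem_nhdsGT (zero_lt_one' ℝ)] with t ht
  rw [slope_def_field]
  exact div_nonneg (sub_nonneg.2 (h t ht.1 ht.2)) (by linarith [ht.1])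

/-- A vector satisfying the variational inequality over the simplex `{x ≥ 0, ∑ x ≤ P}`
satisfies the KKT conditions. -/
theorem exists_multiplier_of_variational {N : ℕ} {P : ℝ} {x G : Fin N → ℝ}
    (hx : ∀ i, 0 ≤ x i) (hs : ∑ i, x i ≤ P)
    (hG : ∀ y : Fin N → ℝ, (∀ i, 0 ≤ y i) → ∑ i, y i ≤ P → 0 ≤ ∑ j, (y j - x j) * G j) :
    ∃ ν : ℝ, ν ≤ 0 ∧ (∀ j, 0 < x j → G j = ν) ∧ (∀ j, x j = 0 → ν ≤ G j) ∧
      (∑ j, x j < P → ν = 0) := by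
  have hdir : ∀ v : Fin N → ℝ, (∀ i, 0 ≤ x i + v i) → ∑ i, x i + ∑ i, v i ≤ P →
      0 ≤ ∑ j, v j * G j := fun v h1 h2 => by
    simpa using hG (fun i => x i + v i) h1 (by rwa [Finset.sum_add_distrib])
  have hneg : ∀ j, 0 < x j → G j ≤ 0 := fun j hj => by
    have h := hdir (Pi.single j (-x j))
      (fun i => by
        rcases eq_or_ne i j with rfl | hij
        · simp
        · simpa [hij] using hx i)
      (by simp; linarith)
    simp [Pi.single_apply] at h
    nlinarith
  have hle : ∀ j k, 0 < x j → G j ≤ G k := fun j k hj => by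
    have h := hdir
      (fun i => Pi.single (M := fun _ => ℝ) k (x j) i - Pi.single (M := fun _ => ℝ) j (x j) i)
      (fun i => by
        have hk : 0 ≤ Pi.single (M := fun _ => ℝ) k (x j) i := by
          rw [Pi.single_apply]; split_ifs <;> linarith
        have hj' : Pi.single (M := fun _ => ℝ) j (x j) i ≤ x i := by
          rw [Pi.single_apply]; split_ifs with e
          exacts [e ▸ le_rfl, hx i]
        linarith)
      (by simpa [Finset.sum_sub_distrib] using hs)
    simp [sub_mul, Finset.sum_sub_distrib, Pi.single_apply] at h
    nlinarith
  have hpos : ∑ j, x j < P → ∀ j, 0 ≤ G j := fun hlt j => by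
    have h := hdir (Pi.single j (P - ∑ i, x i))
      (fun i => by
        have : 0 ≤ Pi.single (M := fun _ => ℝ) j (P - ∑ i, x i) i := by
          rw [Pi.single_apply]; split_ifs <;> linarith
        linarith [hx i])
      (by simp)
    simp [Pi.single_apply] at h
    by_contra! hneg
    nlinarith
  have hinf : ∀ j, Finset.univ.inf' ⟨none, Finset.mem_univ _⟩
      (fun o : Option (Fin N) => o.elim 0 G) ≤ G j := fun j =>
    Finset.inf'_le (fun o : Option (Fin N) => o.elim 0 G) (Finset.mem_univ (some j))
  have hinf0 : Finset.univ.inf' ⟨none, Finset.mem_univ _⟩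
      (fun o : Option (Fin N) => o.elim 0 G) ≤ 0 :=
    Finset.inf'_le (fun o : Option (Fin N) => o.elim 0 G) (Finset.mem_univ none)
  refine ⟨_, hinf0, fun j hj => le_antisymm (Finset.le_inf' _ _ ?_) (hinf j), fun j _ => hinf j,
    fun hlt => le_antisymm hinf0 (Finset.le_inf' _ _ ?_)⟩
  · rintro (_ | k) _
    exacts [hneg j hj, hle j k hj]
  · rintro (_ | k) _
    exacts [le_rfl, hpos hlt k]

/-- Necessary first-order (KKT-type) conditions on an optimal code under a total-power
constraint: there is `ν ≤ 0` such that `∑_{i<K} D_{j+i} π_i = ν` whenever `x1_j > 0`,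
`∑_{i<K} D_{j+i} π_i ≥ ν` whenever `x1_j = 0`, and `ν = 0` if the power of `x1` is
strictly below the budget `P`. -/
theorem stmt12 (K : ℕ) (hK : 1 ≤ K) (N : ℕ) (hN : 1 ≤ N)
    (p : Fin K → ℝ) (hp : ∀ j, 0 ≤ p j) (d : ℝ) (hd : 0 < d) (P : ℝ) (hP : 0 ≤ P)
    (x1 x2 : Fin N → ℝ) (hx1 : ∀ i, 0 ≤ x1 i) (hx2 : ∀ i, 0 ≤ x2 i)
    (hs1 : (∑ i, x1 i) ≤ P) (hs2 : (∑ i, x2 i) ≤ P)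
    (hopt : ∀ y1 y2 : Fin N → ℝ, (∀ i, 0 ≤ y1 i) → (∀ i, 0 ≤ y2 i) →
      (∑ i, y1 i) ≤ P → (∑ i, y2 i) ≤ P →
      Pe d (cconv x1 p) (cconv x2 p) ≤ Pe d (cconv y1 p) (cconv y2 p))
    (a : Fin (N + K - 1) → ℝ)
    (ha : ∀ i, a i = Real.log ((cconv x1 p i + d) / (cconv x2 p i + d)))
    (b : ℝ) (hb : b = ∑ i, (cconv x1 p i - cconv x2 p i))
    (D : Fin (N + K - 1) → ℝ)
    (hD : ∀ i, D i = ∑' y : Fin (N + K - 1) → ℕ,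
        prodPdf (fun j => cconv x1 p j + d) y *
          (((y i : ℝ) / (cconv x1 p i + d) - 1) *
            (if (∑ j, a j * (y j : ℝ)) < b then 1 else 0))) :
    ∃ ν : ℝ, ν ≤ 0 ∧
      (∀ j : Fin N, 0 < x1 j →
        (∑ i : Fin K,
          D ⟨(j : ℕ) + (i : ℕ), by have := j.isLt; have := i.isLt; omega⟩ * p i) = ν) ∧
      (∀ j : Fin N, x1 j = 0 →
        ν ≤ ∑ i : Fin K,
          D ⟨(j : ℕ) + (i : ℕ), by have := j.isLt; have := i.isLt; omega⟩ * p i) ∧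
      ((∑ j, x1 j) < P → ν = 0) := by
  have hl : ∀ z : Fin N → ℝ, (∀ i, 0 ≤ z i) → ∀ i, d ≤ cconv z p i + d :=
    fun z hz i => le_add_of_nonneg_left (cconv_nonneg hz hp i)
  have hl0 : ∀ z : Fin N → ℝ, (∀ i, 0 ≤ z i) → ∀ i, 0 ≤ cconv z p i + d :=
    fun z hz i => hd.le.trans (hl z hz i)
  set S : (Fin (N + K - 1) → ℕ) → Prop := fun y => ∑ j, a j * (y j : ℝ) < b
  set g : (Fin (N + K - 1) → ℕ) → Bool := fun y => !decide (S y) with hg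
  have hratio : ∀ y, prodPdf (fun i => cconv x1 p i + d) y =
      prodPdf (fun i => cconv x2 p i + d) y * Real.exp (∑ j, a j * (y j : ℝ) - b) := fun y => by
    rw [prodPdf_eq_mul_exp (fun i => hd.trans_le (hl x1 hx1 i))
      (fun i => hd.trans_le (hl x2 hx2 i)) y]
    simp only [ha, hb, add_sub_add_right_eq_sub]
  have hPe : Pe d (cconv x1 p) (cconv x2 p) = errProb d (cconv x1 p) (cconv x2 p) g := by
    refine Pe_eq_errProb_of_forall (hl0 x1 hx1) (hl0 x2 hx2) g (fun y hy => ?_) fun y hy => ?_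
    · have hS : ∑ j, a j * (y j : ℝ) < b := by simpa [hg] using hy
      rw [hratio]
      exact mul_le_of_le_one_right (prodPdf_nonneg (hl0 x2 hx2) y)
        (Real.exp_le_one_iff.2 (by linarith))
    · have hS : b ≤ ∑ j, a j * (y j : ℝ) := by simpa [hg, S] using hy
      rw [hratio]
      exact le_mul_of_one_le_right (prodPdf_nonneg (hl0 x2 hx2) y)
        (Real.one_le_exp (by linarith))
  have hmin : ∀ z : Fin N → ℝ, (∀ i, 0 ≤ z i) → ∑ i, z i ≤ P →
      (∑' y, if S y then prodPdf (fun i => cconv x1 p i + d) y else 0) ≤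
        ∑' y, if S y then prodPdf (fun i => cconv z p i + d) y else 0 := fun z hz hzs => by
    have h := (hopt z x2 hz hx2 hzs hs2).trans
      (Pe_le_errProb (hl0 z hz) (hl0 x2 hx2) g)
    rw [hPe] at h
    simp only [errProb, hg, Bool.not_eq_false', decide_eq_true_eq] at h
    linarith
  refine exists_multiplier_of_variational (G := fun j : Fin N => ∑ i : Fin K,
    D ⟨(j : ℕ) + (i : ℕ), by have := j.isLt; have := i.isLt; omega⟩ * p i) hx1 hs1
    fun z hz hzs => ?_
  rw [← sum_cconv_mul]
  have hder := hasDerivAt_tsum_prodPdf hd (hl x1 hx1) (cconv (fun j => z j - x1 j) p) S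
  simp only [S, ← hD] at hder
  refine hder.nonneg_of_forall_le fun t ht0 ht1 => ?_
  have hfeas := hmin (fun j => x1 j + t * (z j - x1 j))
    (fun j => by nlinarith [hx1 j, hz j])
    (by
      rw [Finset.sum_add_distrib, ← Finset.mul_sum, Finset.sum_sub_distrib]
      nlinarith)
  simp only [cconv_add_mul, add_right_comm _ _ d] at hfeas
  simpa only [zero_mul, add_zero] using hfeas
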